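/- Let n ≥ 0, let y ∈ ℝ^{n+1} with ‖y‖ = 1 and let v ∈ ℝ^{n+1} be arbitrary. Then v/(1+‖v‖²) ≠ −2y, so that s(y,v) := σ(y, v/(1+‖v‖²)) is well defined; moreover ‖s(y,v)‖ = 1 and s(y,0) = y. Thus s is a globally defined map 𝕊ⁿ × ℝ^{n+1} → 𝕊ⁿ with s(y,0) = y for all y. -/

import Mathlib

open RealInnerProductSpace

/-- The spray map `σ(y,w) = -y + (⟨2y, w+2y⟩/‖w+2y‖²)·(w+2y)` over the unit sphere. -/
noncomputable def sphereSpray {n : ℕ} (y w : EuclideanSpace ℝ (Fin (n + 1))) :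
    EuclideanSpace ℝ (Fin (n + 1)) :=
  -y + (⟪(2 : ℝ) • y, w + (2 : ℝ) • y⟫ / ‖w + (2 : ℝ) • y‖ ^ 2) • (w + (2 : ℝ) • y)

theorem norm_sphereSpray {n : ℕ} (y w : EuclideanSpace ℝ (Fin (n + 1))) :
    ‖sphereSpray y w‖ = ‖y‖ := by
  rw [← sq_eq_sq₀ (norm_nonneg _) (norm_nonneg _)]
  unfold sphereSpray
  generalize w + (2 : ℝ) • y = u
  rw [norm_add_sq_real, norm_neg, inner_neg_left, inner_smul_right, inner_smul_left, norm_smul,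
    mul_pow, Real.norm_eq_abs, sq_abs, conj_trivial]
  rcases eq_or_ne u 0 with rfl | hu
  · simp
  · have : ‖u‖ ≠ 0 := norm_ne_zero_iff.mpr hu
    field_simp
    ring

theorem sphereSpray_zero {n : ℕ} (y : EuclideanSpace ℝ (Fin (n + 1))) :
    sphereSpray y 0 = y := by
  rcases eq_or_ne y 0 with rfl | hy
  · simp [sphereSpray]
  · have h : ‖(2 : ℝ) • y‖ ^ 2 ≠ 0 := by simpa using hy
    rw [sphereSpray, zero_add, real_inner_self_eq_norm_sq, div_self h]
    module

theorem norm_inv_one_add_norm_sq_smul_lt_one {E : Type*} [SeminormedAddCommGroup E]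
    [NormedSpace ℝ E] (v : E) : ‖(1 + ‖v‖ ^ 2)⁻¹ • v‖ < 1 := by
  have h : 0 < 1 + ‖v‖ ^ 2 := by positivity
  rw [norm_smul, Real.norm_of_nonneg (inv_nonneg.mpr h.le), inv_mul_lt_one₀ h]
  nlinarith [sq_nonneg (‖v‖ - 1 / 2)]

/-- The globally defined spray `s(y,v) := σ(y, v/(1+‖v‖²))`: for every `y` on the unit
sphere and every `v`, the rescaled vector `v/(1+‖v‖²)` is different from `-2y`, the point
`s(y,v)` lies on the unit sphere, and `s(y,0) = y`. -/
theorem sphereSpray_global (n : ℕ) (y v : EuclideanSpace ℝ (Fin (n + 1))) (hy : ‖y‖ = 1) :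
    (1 + ‖v‖ ^ 2)⁻¹ • v ≠ -((2 : ℝ) • y) ∧
    ‖sphereSpray y ((1 + ‖v‖ ^ 2)⁻¹ • v)‖ = 1 ∧
    sphereSpray y ((1 + ‖(0 : EuclideanSpace ℝ (Fin (n + 1)))‖ ^ 2)⁻¹ •
      (0 : EuclideanSpace ℝ (Fin (n + 1)))) = y := by
  refine ⟨fun h => ?_, (norm_sphereSpray _ _).trans hy, ?_⟩
  · have hlt := norm_inv_one_add_norm_sq_smul_lt_one v
    rw [h, norm_neg, norm_smul, hy] at hlt
    norm_num at hlt
  · rw [smul_zero, sphereSpray_zero]
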